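/- arXiv:2504.09270 — 8 statements merged into one kernel-verified Lean document; each statement's English description precedes it below -/
import Mathlib

section
/- For every J ⊆ 𝒥 one has (s^{J^s}_j, t^{J^s}_j) = (s^{(J−1)^{ss}}_j, t^{(J−1)^{ss}}_j) for all j ∈ 𝒥 if and only if J Δ (J−1)^{ss} = 𝒥. Moreover, if J_ρ ≠ 𝒥, then there is exactly one subset J* ⊆ 𝒥 with J* Δ (J*−1)^{ss} = 𝒥, and it is characterized by: j ∈ J* if and only if (j ∉ J_ρ, or (j ∈ J_ρ and j+1 ∉ J*)). -/
open Finset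
open scoped symmDiff

def shiftSet (f : ℕ) (J : Finset (ZMod f)) (k : ℤ) : Finset (ZMod f) :=
  J.image (fun j => j + (k : ZMod f))

def deltaSS (f : ℕ) (Jrho J : Finset (ZMod f)) : Finset (ZMod f) :=
  shiftSet f J (-1) ∩ Jrho

def sfun (p f : ℕ) (r : ZMod f → ℤ) (Jrho J : Finset (ZMod f)) (j : ZMod f) : ℤ :=
  if j ∈ J then
    if j + 1 ∈ J then (if j ∈ Jrho then (p : ℤ) - 3 - r j else (p : ℤ) - 1 - r j)
    else r j + 1
  else
    if j + 1 ∈ J then (p : ℤ) - 2 - r j else r j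

def tfun (f : ℕ) (r : ZMod f → ℤ) (Jrho J : Finset (ZMod f)) (j : ZMod f) : ℤ :=
  if j ∈ J then
    if j + 1 ∈ J then (if j ∈ Jrho then r j + 1 else r j)
    else -1
  else
    if j + 1 ∈ J then r j + 1 else 0


theorem mem_deltaSS {f : ℕ} {Jrho J : Finset (ZMod f)} {j : ZMod f} :
    j ∈ deltaSS f Jrho J ↔ j + 1 ∈ J ∧ j ∈ Jrho := by
  simp only [deltaSS, shiftSet, mem_inter, mem_image, Int.cast_neg, Int.cast_one]
  refine and_congr_left fun _ => ⟨?_, fun h => ⟨j + 1, h, by ring⟩⟩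
  rintro ⟨a, ha, rfl⟩
  simpa using ha

theorem symmDiff_deltaSS_eq_univ_iff {f : ℕ} [NeZero f] {Jrho J : Finset (ZMod f)} :
    J ∆ deltaSS f Jrho J = univ ↔ ∀ j, j ∈ J ↔ ¬(j + 1 ∈ J ∧ j ∈ Jrho) := by
  simp only [Finset.ext_iff, mem_symmDiff, mem_deltaSS, mem_univ, iff_true]
  exact forall_congr' fun j => by tauto

/-- The two defining equations determine membership at `j` once `r j` is positive. -/
theorem mem_iff_of_sfun_tfun_eq {p f : ℕ} {r : ZMod f → ℤ} {Jrho J : Finset (ZMod f)} {j : ZMod f}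
    (hr : 0 < r j)
    (hs : (p : ℤ) - 1 - sfun p f r Jrho J j = sfun p f r Jrho (deltaSS f Jrho J) j)
    (ht : r j - tfun f r Jrho J j = tfun f r Jrho (deltaSS f Jrho J) j) :
    j ∈ J ↔ ¬(j + 1 ∈ J ∧ j ∈ Jrho) := by
  simp only [sfun, tfun, mem_deltaSS] at hs ht
  by_cases ha : j ∈ J <;> by_cases hb : j + 1 ∈ J <;> by_cases hc : j ∈ Jrho <;>
    simp only [ha, hb, hc, if_true, if_false, and_true, and_false,
      not_true, not_false_iff, iff_true, iff_false] at hs ht ⊢ <;>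
    split_ifs at hs ht <;> omega

theorem sfun_tfun_eq_of_forall_mem_iff {p f : ℕ} {r : ZMod f → ℤ} {Jrho J : Finset (ZMod f)}
    (h : ∀ j, j ∈ J ↔ ¬(j + 1 ∈ J ∧ j ∈ Jrho)) (j : ZMod f) :
    (p : ℤ) - 1 - sfun p f r Jrho J j = sfun p f r Jrho (deltaSS f Jrho J) j ∧
      r j - tfun f r Jrho J j = tfun f r Jrho (deltaSS f Jrho J) j := by
  have compl (i : ZMod f) : i ∈ deltaSS f Jrho J ↔ i ∉ J := by
    rw [mem_deltaSS, h i, not_not]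
  have hj := h j
  simp only [sfun, tfun, compl]
  by_cases ha : j ∈ J <;> by_cases hb : j + 1 ∈ J <;> by_cases hc : j ∈ Jrho <;>
    simp [ha, hb, hc] at hj ⊢ <;> omega

theorem eq_of_forall_mem_iff {f : ℕ} [NeZero f] {Jrho J J' : Finset (ZMod f)}
    (hne : Jrho ≠ univ) (h : ∀ j, j ∈ J ↔ ¬(j + 1 ∈ J ∧ j ∈ Jrho))
    (h' : ∀ j, j ∈ J' ↔ ¬(j + 1 ∈ J' ∧ j ∈ Jrho)) : J = J' := by
  by_contra hJ
  obtain ⟨j, hj⟩ : ∃ j, ¬(j ∈ J ↔ j ∈ J') := by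
    simpa [Finset.ext_iff] using hJ
  have step (i : ZMod f) (hi : ¬(i ∈ J ↔ i ∈ J')) :
      i ∈ Jrho ∧ ¬(i + 1 ∈ J ↔ i + 1 ∈ J') := by
    have := h i
    have := h' i
    tauto
  have all (n : ℕ) : ¬(j + n ∈ J ↔ j + n ∈ J') := by
    induction n with
    | zero => simpa using hj
    | succ n ih => simpa [add_assoc] using (step _ ih).2
  refine hne (eq_univ_iff_forall.2 fun i => ?_)
  simpa using (step _ (all (i - j).val)).1

theorem exists_forall_mem_iff {f : ℕ} [NeZero f] {Jrho : Finset (ZMod f)} (hne : Jrho ≠ univ) :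
    ∃ J : Finset (ZMod f), ∀ j, j ∈ J ↔ ¬(j + 1 ∈ J ∧ j ∈ Jrho) := by
  obtain ⟨i, hi⟩ : ∃ i, i ∉ Jrho := by
    simpa [eq_univ_iff_forall] using hne
  have ex (j : ZMod f) : ∃ n : ℕ, j + n ∉ Jrho := ⟨(i - j).val, by simpa using hi⟩
  refine ⟨univ.filter fun j => Even (Nat.find (ex j)), fun j => ?_⟩
  simp only [mem_filter, mem_univ, true_and]
  by_cases hj : j ∈ Jrho
  · have hfind : Nat.find (ex j) = Nat.find (ex (j + 1)) + 1 := by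
      have ex' : ∃ n : ℕ, j + (n + 1 : ℕ) ∉ Jrho := by
        simpa [add_assoc, add_comm, add_left_comm] using ex (j + 1)
      rw [Nat.find_comp_succ (ex j) ex' (by simpa using hj)]
      congr 1
      exact Nat.find_congr' fun {n} => by
        rw [Nat.cast_succ, add_assoc, add_comm (1 : ZMod f)]
    simp [hfind, hj, Nat.even_add_one]
  · have hfind : Nat.find (ex j) = 0 := by simpa using hj
    simp [hfind, hj]

/-- For every `J ⊆ 𝒥` one has
`(s^{J^s}_j, t^{J^s}_j) = (s^{(J−1)^{ss}}_j, t^{(J−1)^{ss}}_j)` for all `j` iff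
`J ∆ (J−1)^{ss} = 𝒥`; moreover if `J_ρ ≠ 𝒥` there is a unique `J*` with
`J* ∆ (J*−1)^{ss} = 𝒥`, characterized by `j ∈ J* ↔ (j ∉ J_ρ ∨ (j ∈ J_ρ ∧ j+1 ∉ J*))`. -/
theorem statement0 (p f : ℕ) [NeZero f] (hp : p.Prime) (hf : 1 ≤ f)
    (r : ZMod f → ℤ)
    (hr : ∀ j, max 12 (2 * (f : ℤ) + 1) ≤ r j ∧ r j ≤ (p : ℤ) - max 15 (2 * (f : ℤ) + 3))
    (Jrho : Finset (ZMod f)) :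
    (∀ J : Finset (ZMod f),
      ((∀ j : ZMod f,
          (p : ℤ) - 1 - sfun p f r Jrho J j = sfun p f r Jrho (deltaSS f Jrho J) j ∧
          r j - tfun f r Jrho J j = tfun f r Jrho (deltaSS f Jrho J) j)
        ↔ J ∆ deltaSS f Jrho J = Finset.univ)) ∧
    (Jrho ≠ Finset.univ →
      (∃! Jstar : Finset (ZMod f), Jstar ∆ deltaSS f Jrho Jstar = Finset.univ) ∧
      ∀ Jstar : Finset (ZMod f), Jstar ∆ deltaSS f Jrho Jstar = Finset.univ →
        ∀ j : ZMod f, j ∈ Jstar ↔ (j ∉ Jrho ∨ (j ∈ Jrho ∧ j + 1 ∉ Jstar))) := by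
  refine ⟨fun J => ?_, fun hne => ⟨?_, fun J hJ j => ?_⟩⟩
  · rw [symmDiff_deltaSS_eq_univ_iff]
    refine ⟨fun h j => mem_iff_of_sfun_tfun_eq ?_ (h j).1 (h j).2,
      sfun_tfun_eq_of_forall_mem_iff⟩
    have := (le_max_left _ _).trans (hr j).1
    omega
  · simp only [symmDiff_deltaSS_eq_univ_iff]
    obtain ⟨J, hJ⟩ := exists_forall_mem_iff hne
    exact ⟨J, hJ, fun J' hJ' => eq_of_forall_mem_iff hne hJ' hJ⟩
  · have := symmDiff_deltaSS_eq_univ_iff.1 hJ j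
    tauto
end

section
/- For all J, J′ ⊆ 𝒥, the integer Σ_{j=0}^{f−1} t^J_j + Σ_{j=0}^{f−1} t^{J^s}_j + Σ_{j=0}^{f−1} s^{J′}_j is even (equivalently, (−1)^{t^J + t^{J^s} + s^{J′}} = 1). -/
open Finset
open scoped symmDiff

/-- When `p` is odd, `r_j + s^J_j` has the parity of `1_{j ∈ J} + 1_{j + 1 ∈ J}`. -/
theorem even_add_sfun_sub_indicators {p : ℕ} (hp : Odd p) (f : ℕ) (r : ZMod f → ℤ)
    (Jrho J : Finset (ZMod f)) (j : ZMod f) :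
    Even (r j + sfun p f r Jrho J j -
      ((if j ∈ J then (1 : ℤ) else 0) + (if j + 1 ∈ J then (1 : ℤ) else 0))) := by
  obtain ⟨k, rfl⟩ := hp
  unfold sfun
  rw [Int.even_iff]
  push_cast
  split_ifs <;> omega

/-- When `p` is odd, `∑ j, (r_j + s^J_j)` is even. -/
theorem even_sum_add_sfun {p : ℕ} (hp : Odd p) (f : ℕ) [NeZero f] (r : ZMod f → ℤ)
    (Jrho J : Finset (ZMod f)) :
    Even (∑ j : ZMod f, (r j + sfun p f r Jrho J j)) := by
  have hshift : ∑ j : ZMod f, (if j + 1 ∈ J then (1 : ℤ) else 0) =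
      ∑ j : ZMod f, (if j ∈ J then (1 : ℤ) else 0) :=
    Equiv.sum_comp (Equiv.addRight (1 : ZMod f)) fun j => if j ∈ J then (1 : ℤ) else 0
  have hsum := Finset.even_sum (s := Finset.univ) _ fun j _ =>
    even_add_sfun_sub_indicators hp f r Jrho J j
  rw [Finset.sum_sub_distrib, Finset.sum_add_distrib (f := fun j => if j ∈ J then (1 : ℤ) else 0),
    hshift] at hsum
  exact (Int.even_sub.mp hsum).mpr (Even.add_self _)

/-- `Σ t^J_j + Σ t^{J^s}_j + Σ s^{J′}_j` is even. -/
theorem statement3 (p f : ℕ) [NeZero f] (hp : p.Prime) (hf : 1 ≤ f)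
    (r : ZMod f → ℤ)
    (hr : ∀ j, max 12 (2 * (f : ℤ) + 1) ≤ r j ∧ r j ≤ (p : ℤ) - max 15 (2 * (f : ℤ) + 3))
    (Jrho : Finset (ZMod f)) :
    ∀ J J' : Finset (ZMod f),
      Even ((∑ j : ZMod f, tfun f r Jrho J j) +
            (∑ j : ZMod f, (r j - tfun f r Jrho J j)) +
            (∑ j : ZMod f, sfun p f r Jrho J' j)) := by
  intro J J'
  have hodd : Odd p := hp.odd_of_ne_two (by have := hr 0; omega)
  rw [← Finset.sum_add_distrib, ← Finset.sum_add_distrib]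
  simpa only [add_sub_cancel] using even_sum_add_sfun hodd f r Jrho J'
end

section
/- For every J ⊆ 𝒥 and j ∈ 𝒥: s^J_j + 1_{j+1 ∉ J_0 Δ J}·c′_j = 1_{j+1 ∈ J_0 Δ J}·s^J_j + 1_{j+1 ∉ J_0 Δ J}·(p−1). -/
open Finset
open scoped symmDiff

def Jzero (f : ℕ) [NeZero f] (Jrho J : Finset (ZMod f)) : Finset (ZMod f) :=
  shiftSet f ((J ∩ Jrho) ∪ (shiftSet f Jᶜ (-1) \ Jrho)) 1

def cprime (p f : ℕ) [NeZero f] (r : ZMod f → ℤ) (Jrho J : Finset (ZMod f))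
    (j : ZMod f) : ℤ :=
  2 * (if j ∈ Jzero f Jrho J ∩ (J \ Jrho) then 1 else 0) + (p : ℤ) - 1
    - sfun p f r Jrho (Jzero f Jrho J) j + (if j ∈ Jzero f Jrho J ∆ J then 1 else 0)


theorem mem_shiftSet_iff {f : ℕ} (J : Finset (ZMod f)) (k : ℤ) (j : ZMod f) :
    j ∈ shiftSet f J k ↔ j - (k : ZMod f) ∈ J := by
  simp only [shiftSet, mem_image, ← eq_sub_iff_add_eq, exists_eq_right]

theorem add_one_mem_Jzero_iff {f : ℕ} [NeZero f] (Jrho J : Finset (ZMod f)) (j : ZMod f) :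
    j + 1 ∈ Jzero f Jrho J ↔ (j ∈ J ∧ j ∈ Jrho) ∨ (j + 1 ∉ J ∧ j ∉ Jrho) := by
  have hshift := mem_shiftSet_iff Jᶜ (-1) j
  simp only [Int.cast_neg, Int.cast_one, sub_neg_eq_add, mem_compl] at hshift
  simp [Jzero, mem_shiftSet_iff _ 1, hshift]

theorem statement5 (p f : ℕ) [NeZero f] (hp : p.Prime) (hf : 1 ≤ f)
    (r : ZMod f → ℤ)
    (hr : ∀ j, max 12 (2 * (f : ℤ) + 1) ≤ r j ∧ r j ≤ (p : ℤ) - max 15 (2 * (f : ℤ) + 3))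
    (Jrho : Finset (ZMod f)) :
    ∀ (J : Finset (ZMod f)) (j : ZMod f),
      sfun p f r Jrho J j
        + (if j + 1 ∉ Jzero f Jrho J ∆ J then 1 else 0) * cprime p f r Jrho J j
      = (if j + 1 ∈ Jzero f Jrho J ∆ J then 1 else 0) * sfun p f r Jrho J j
        + (if j + 1 ∉ Jzero f Jrho J ∆ J then 1 else 0) * ((p : ℤ) - 1) := by
  intro J j
  have h := add_one_mem_Jzero_iff Jrho J j
  simp only [cprime, sfun, mem_symmDiff, mem_inter, mem_sdiff]
  by_cases hrho : j ∈ Jrho <;> by_cases hj : j ∈ J <;> by_cases hj1 : j + 1 ∈ J <;>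
    by_cases hj0 : j ∈ Jzero f Jrho J <;>
    simp only [hrho, hj, hj1, not_true_eq_false, not_false_eq_true, and_true, and_false,
      or_false, or_true, iff_true, iff_false] at h <;>
    simp [hrho, hj, hj1, hj0, h] <;> ring
end

section
/- For every J ⊆ 𝒥 and j ∈ 𝒥: 1_{j+1 ∉ J^{nss}}·s^{J^{ss}}_j + 1_{j+1 ∈ J^{nss}}·(p−1) + 1_{j+1 ∉ J_0 Δ J}·c′_j = 1_{j+1 ∈ J_0 ∩ J^{nss}}·p + 1_{j+1 ∈ J_0 Δ J^{ss}}·s^{J^{ss}}_j + 1_{j+1 ∉ J_0 Δ J^{ss}}·(p−1). -/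
open Finset
open scoped symmDiff

theorem mem_shiftSet {f : ℕ} {J : Finset (ZMod f)} {k : ℤ} {j : ZMod f} :
    j ∈ shiftSet f J k ↔ j - (k : ZMod f) ∈ J := by
  simp [shiftSet, sub_eq_add_neg]

theorem add_one_mem_Jzero {f : ℕ} [NeZero f] {Jrho J : Finset (ZMod f)} {j : ZMod f} :
    j + 1 ∈ Jzero f Jrho J ↔ j ∈ J ∧ j ∈ Jrho ∨ j + 1 ∉ J ∧ j ∉ Jrho := by
  simp [Jzero, mem_shiftSet]

theorem statement6 (p f : ℕ) [NeZero f] (hp : p.Prime) (hf : 1 ≤ f)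
    (r : ZMod f → ℤ)
    (hr : ∀ j, max 12 (2 * (f : ℤ) + 1) ≤ r j ∧ r j ≤ (p : ℤ) - max 15 (2 * (f : ℤ) + 3))
    (Jrho : Finset (ZMod f)) :
    ∀ (J : Finset (ZMod f)) (j : ZMod f),
      (if j + 1 ∉ J \ Jrho then 1 else 0) * sfun p f r Jrho (J ∩ Jrho) j
        + (if j + 1 ∈ J \ Jrho then 1 else 0) * ((p : ℤ) - 1)
        + (if j + 1 ∉ Jzero f Jrho J ∆ J then 1 else 0) * cprime p f r Jrho J j
      = (if j + 1 ∈ Jzero f Jrho J ∩ (J \ Jrho) then 1 else 0) * (p : ℤ)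
        + (if j + 1 ∈ Jzero f Jrho J ∆ (J ∩ Jrho) then 1 else 0) * sfun p f r Jrho (J ∩ Jrho) j
        + (if j + 1 ∉ Jzero f Jrho J ∆ (J ∩ Jrho) then 1 else 0) * ((p : ℤ) - 1) := by
  intro J j
  simp only [cprime, sfun, mem_symmDiff, mem_inter, mem_sdiff, add_one_mem_Jzero]
  by_cases hj : j ∈ J <;> by_cases hjr : j ∈ Jrho <;> by_cases hj' : j + 1 ∈ J <;>
    by_cases hjr' : j + 1 ∈ Jrho <;> by_cases hj0 : j ∈ Jzero f Jrho J <;>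
    simp [hj, hjr, hj', hjr', hj0] <;> ring
end

section
/- For every J ⊆ 𝒥, one has in ℤ/pℤ: (−1)^{Σ_{j=0}^{f−1}(t^J_j + t^{J^s}_j)} · Π_{j=0}^{f−1} (s^J_j)! · (s^{J^s}_j)! = (−1)^f. (Under the stated bounds on the r_j, each s^J_j and s^{J^s}_j = p−1−s^J_j lies in {0,…,p−1}, so the factorials are well defined and nonzero mod p.) -/
open Finset
open scoped symmDiff

/-- A form of Wilson's theorem: `a! * b! = (-1)^(a+1)` modulo `p` whenever `a + b = p - 1`. -/
theorem factorial_mul_factorial_of_add_eq {p : ℕ} [Fact p.Prime] (a b : ℕ) (h : a + b + 1 = p) :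
    (a.factorial : ZMod p) * (b.factorial : ZMod p) = (-1) ^ (a + 1) := by
  induction a generalizing b with
  | zero =>
    have hb : b = p - 1 := by omega
    simp [hb, ZMod.wilsons_lemma]
  | succ a ih =>
    have ih' := ih (b + 1) (by omega)
    have hcast : (a : ZMod p) + 1 = -((b : ZMod p) + 1) := by
      have : ((a + 1 + b + 1 : ℕ) : ZMod p) = 0 := by rw [h, ZMod.natCast_self]
      push_cast at this
      linear_combination this
    rw [Nat.factorial_succ] at ih' ⊢
    push_cast at ih' ⊢
    rw [pow_succ, ← ih', hcast]
    ring

theorem factorial_mul_factorial_toNat {p : ℕ} [Fact p.Prime] {s : ℤ} (h0 : 0 ≤ s)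
    (h1 : s ≤ (p : ℤ) - 1) :
    (s.toNat.factorial : ZMod p) * (((p : ℤ) - 1 - s).toNat.factorial : ZMod p) =
      (-1) ^ (s + 1) := by
  rw [factorial_mul_factorial_of_add_eq _ _ (by omega), ← zpow_natCast]
  congr 1
  omega

theorem zpow_sum_eq_prod {ι K : Type*} [Field K] {x : K} (hx : x ≠ 0) (s : Finset ι)
    (n : ι → ℤ) : x ^ (∑ i ∈ s, n i) = ∏ i ∈ s, x ^ n i := by
  classical
  induction s using Finset.induction_on with
  | empty => simp
  | insert i s hi ih => rw [sum_insert hi, prod_insert hi, zpow_add₀ hx, ih]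

theorem sfun_mem_Icc {p f : ℕ} (r : ZMod f → ℤ) (Jrho J : Finset (ZMod f)) (j : ZMod f)
    (h1 : 12 ≤ r j) (h2 : r j ≤ (p : ℤ) - 15) :
    0 ≤ sfun p f r Jrho J j ∧ sfun p f r Jrho J j ≤ (p : ℤ) - 1 := by
  unfold sfun
  split_ifs <;> omega

/-- in `ℤ/pℤ`, `(−1)^{Σ(t^J_j+t^{J^s}_j)} Π (s^J_j)!(s^{J^s}_j)! = (−1)^f`. -/
theorem statement14 (p f : ℕ) [NeZero f] [Fact p.Prime] (hf : 1 ≤ f)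
    (r : ZMod f → ℤ)
    (hr : ∀ j, max 12 (2 * (f : ℤ) + 1) ≤ r j ∧ r j ≤ (p : ℤ) - max 15 (2 * (f : ℤ) + 3))
    (Jrho : Finset (ZMod f)) :
    ∀ J : Finset (ZMod f),
      (-1 : ZMod p) ^ (∑ j : ZMod f, (tfun f r Jrho J j + (r j - tfun f r Jrho J j))) *
        ∏ j : ZMod f,
          ((Nat.factorial (sfun p f r Jrho J j).toNat : ZMod p) *
            (Nat.factorial ((p : ℤ) - 1 - sfun p f r Jrho J j).toNat : ZMod p))
      = (-1 : ZMod p) ^ f := by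
  intro J
  have hodd : Odd (p : ℤ) := by
    have h := (hr 0).1.trans (hr 0).2
    have h1 := le_max_left 12 (2 * (f : ℤ) + 1)
    have h2 := le_max_left 15 (2 * (f : ℤ) + 3)
    exact_mod_cast (Fact.out : p.Prime).odd_of_ne_two (by omega)
  have hp0 : (-1 : ZMod p) ≠ 0 := neg_ne_zero.2 one_ne_zero
  have hterm (j : ZMod f) :
      (-1 : ZMod p) ^ (r j) *
        ((Nat.factorial (sfun p f r Jrho J j).toNat : ZMod p) *
          (Nat.factorial ((p : ℤ) - 1 - sfun p f r Jrho J j).toNat : ZMod p)) =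
      -1 * ((if j ∈ J then -1 else 1) * (if j + 1 ∈ J then -1 else 1)) := by
    have hs := sfun_mem_Icc r Jrho J j
      ((le_max_left _ _).trans (hr j).1)
      ((hr j).2.trans (sub_le_sub_left (le_max_left _ _) _))
    rw [factorial_mul_factorial_toNat hs.1 hs.2, ← zpow_add₀ hp0]
    obtain ⟨k, hk⟩ := hodd
    unfold sfun
    split_ifs <;> norm_num
    all_goals first
      | exact Odd.neg_one_zpow (by grind)
      | exact Even.neg_one_zpow (by grind)
  have hshift : ∏ j : ZMod f, (if j + 1 ∈ J then (-1 : ZMod p) else 1) =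
      ∏ j : ZMod f, (if j ∈ J then (-1 : ZMod p) else 1) :=
    Equiv.prod_comp (Equiv.addRight (1 : ZMod f)) (fun j => if j ∈ J then (-1 : ZMod p) else 1)
  have hsq : (∏ j : ZMod f, (if j ∈ J then (-1 : ZMod p) else 1)) *
      ∏ j : ZMod f, (if j ∈ J then (-1 : ZMod p) else 1) = 1 := by
    rw [← prod_mul_distrib]
    exact prod_eq_one fun j _ => by split_ifs <;> simp
  simp only [add_sub_cancel]
  rw [zpow_sum_eq_prod hp0, ← prod_mul_distrib, prod_congr rfl fun j _ => hterm j,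
    prod_mul_distrib, prod_mul_distrib, hshift, hsq, mul_one, prod_const, card_univ, ZMod.card]
end

section
/- Assume ∅ ≠ J_ρ and J_ρ ≠ 𝒥, and let J* ⊆ 𝒥 be the unique subset such that, for all j ∈ 𝒥, j ∈ J* if and only if (j ∉ J_ρ, or (j ∈ J_ρ and j+1 ∉ J*)). Then |J* ∩ ((J*−1) ∖ J_ρ)| ≡ f (mod 2). -/
open Finset
open scoped symmDiff

/-- `|J* ∩ ((J*−1) ∖ J_ρ)| ≡ f (mod 2)`. -/
theorem statement15 (f : ℕ) [NeZero f] (hf : 1 ≤ f) (Jrho : Finset (ZMod f))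
    (h1 : Jrho ≠ ∅) (h2 : Jrho ≠ Finset.univ)
    (Jstar : Finset (ZMod f))
    (hstar : ∀ j : ZMod f, j ∈ Jstar ↔ (j ∉ Jrho ∨ (j ∈ Jrho ∧ j + 1 ∉ Jstar))) :
    (Jstar ∩ (shiftSet f Jstar (-1) \ Jrho)).card ≡ f [MOD 2] := by
  have mem_shift (j : ZMod f) : j ∈ shiftSet f Jstar (-1) ↔ j + 1 ∈ Jstar := by
    simp [shiftSet, ← sub_eq_add_neg, sub_eq_iff_eq_add]
  have indicator_add (j : ZMod f) :
      (if j ∈ Jstar then 1 else 0) + (if j + 1 ∈ Jstar then 1 else 0) =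
        1 + (if j ∈ Jstar ∩ (shiftSet f Jstar (-1) \ Jrho) then 1 else 0) := by
    have := hstar j
    simp only [mem_inter, mem_sdiff, mem_shift]
    split_ifs <;> first | rfl | tauto
  have shift_sum : ∑ j : ZMod f, (if j + 1 ∈ Jstar then 1 else 0) = Jstar.card := by
    refine (Equiv.sum_comp (Equiv.addRight (1 : ZMod f))
      (fun j => if j ∈ Jstar then 1 else 0)).trans ?_
    simp
  have double_count :
      Jstar.card + Jstar.card = f + (Jstar ∩ (shiftSet f Jstar (-1) \ Jrho)).card := by
    have := Finset.sum_congr (rfl : (univ : Finset (ZMod f)) = univ) fun j _ => indicator_add j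
    rw [sum_add_distrib, sum_add_distrib, shift_sum] at this
    simpa only [sum_boole, filter_univ_mem, sum_const, card_univ, ZMod.card, smul_eq_mul,
      mul_one, Nat.cast_id] using this
  unfold Nat.ModEq
  omega
end

section
/- Let J ⊆ 𝒥 with J ⊄ J_ρ. Then Σ_{j : j+1 ∉ J^{nss}}(p−1−s^{J^{ss}}_j)p^j + Σ_{j=0}^{f−1} s^J_j p^j ≡ Σ_{j : j+1 ∈ J^{nss}}(p−1−s^{J^{ss}}_j)p^j (mod q−1), and the right-hand side lies in {0,…,q−2}; hence the base-p digits of the representative mod (q−1) of the left-hand side are exactly 1_{j+1 ∈ J^{nss}}·(p−1−s^{J^{ss}}_j) for 0 ≤ j ≤ f−1. -/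
open Finset
open scoped symmDiff

/-- The `j`-th base-`p` digit of the representative in `{0,…,q−2}` of `a` mod `q−1`. -/
def dig (p f : ℕ) (a : ℤ) (j : ℕ) : ℕ :=
  ((a % ((p : ℤ) ^ f - 1)).toNat / p ^ j) % p


theorem sum_zmod_eq_sum_range (f : ℕ) [NeZero f] (g : ZMod f → ℤ) :
    ∑ j : ZMod f, g j = ∑ i ∈ range f, g (i : ZMod f) := by
  refine Finset.sum_bij' (fun j _ => j.val) (fun i _ => (i : ZMod f)) ?_ ?_ ?_ ?_ ?_
  · intro j _
    exact mem_range.2 (ZMod.val_lt j)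
  · intro i _
    exact mem_univ _
  · intro j _
    exact ZMod.natCast_zmod_val j
  · intro i hi
    exact ZMod.val_cast_of_lt (mem_range.1 hi)
  · intro j _
    rw [ZMod.natCast_zmod_val]

theorem sum_zmod_mul_pow_val (p : ℤ) (f : ℕ) [NeZero f] (g : ZMod f → ℤ) :
    ∑ j : ZMod f, g j * p ^ j.val = ∑ i ∈ range f, g (i : ZMod f) * p ^ i := by
  rw [sum_zmod_eq_sum_range f (fun j => g j * p ^ j.val)]
  refine Finset.sum_congr rfl fun i hi => ?_
  rw [ZMod.val_cast_of_lt (mem_range.1 hi)]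

/-- Carrying cyclically through all `f` places contributes a multiple of `p ^ f - 1`. -/
theorem sum_zmod_carry (p : ℤ) (f : ℕ) [NeZero f] (e : ZMod f → ℤ) :
    ∑ j : ZMod f, (p * e (j + 1) - e j) * p ^ j.val = (p ^ f - 1) * e 0 := by
  rw [sum_zmod_mul_pow_val p f (fun j => p * e (j + 1) - e j)]
  have h := Finset.sum_range_sub (fun i : ℕ => p ^ i * e (i : ZMod f)) f
  simp only [ZMod.natCast_self, Nat.cast_zero, pow_zero] at h
  rw [sub_mul, ← h]
  refine Finset.sum_congr rfl fun i _ => ?_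
  push_cast
  ring

theorem sum_mul_pow_lt {p : ℕ} (n : ℕ) (a : ℕ → ℕ) (ha : ∀ i < n, a i < p) :
    ∑ i ∈ range n, a i * p ^ i < p ^ n := by
  induction n with
  | zero => simp
  | succ n ih =>
    have h₁ := ih fun i hi => ha i (by omega)
    have h₂ := Nat.mul_le_mul_right (p ^ n) (Nat.succ_le_of_lt (ha n (by omega)))
    rw [Finset.sum_range_succ, pow_succ']
    rw [Nat.succ_mul] at h₂
    omega

theorem sum_mul_pow_div_mod {p : ℕ} (n : ℕ) (a : ℕ → ℕ) (ha : ∀ i < n, a i < p)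
    {k : ℕ} (hk : k < n) : (∑ i ∈ range n, a i * p ^ i) / p ^ k % p = a k := by
  have hp : 0 < p := lt_of_le_of_lt (Nat.zero_le _) (ha k hk)
  induction n generalizing a k with
  | zero => omega
  | succ n ih =>
    have hsum : ∑ i ∈ range (n + 1), a i * p ^ i
        = a 0 + p * ∑ i ∈ range n, a (i + 1) * p ^ i := by
      rw [Finset.sum_range_succ', Finset.mul_sum, add_comm]
      congr 1
      · simp
      · exact Finset.sum_congr rfl fun i _ => by ring
    have h₀ := ha 0 (by omega)
    rw [hsum]
    cases k with
    | zero => rw [pow_zero, Nat.div_one, Nat.add_mul_mod_self_left, Nat.mod_eq_of_lt h₀]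
    | succ k =>
      rw [pow_succ', ← Nat.div_div_eq_div_mul, Nat.add_mul_div_left _ _ hp,
        Nat.div_eq_of_lt h₀, zero_add]
      exact ih (fun i => a (i + 1)) (fun i hi => ha (i + 1) (by omega)) (by omega)

/-- Passing from `J ∩ Jrho` to `J` changes the digits only by a carry. -/
theorem sfun_carry (p f : ℕ) (r : ZMod f → ℤ) (Jrho J : Finset (ZMod f)) (j : ZMod f) :
    (if j + 1 ∉ J \ Jrho then (p : ℤ) - 1 - sfun p f r Jrho (J ∩ Jrho) j else 0)
        + sfun p f r Jrho J j
        - (if j + 1 ∈ J \ Jrho then (p : ℤ) - 1 - sfun p f r Jrho (J ∩ Jrho) j else 0)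
      = p * (if j + 1 ∈ J \ Jrho then 0 else 1) - (if j ∈ J \ Jrho then 0 else 1) := by
  simp only [sfun, mem_sdiff, mem_inter]
  by_cases h₁ : j ∈ J <;> by_cases h₂ : j + 1 ∈ J <;> by_cases h₃ : j ∈ Jrho <;>
    by_cases h₄ : j + 1 ∈ Jrho <;> simp [h₁, h₂, h₃, h₄] <;> ring

theorem sfun_inter_mem_bounds {p f : ℕ} {r : ZMod f → ℤ} (Jrho J : Finset (ZMod f)) (j : ZMod f)
    (h₀ : 1 ≤ r j) (h₁ : r j ≤ (p : ℤ) - 4) :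
    1 ≤ sfun p f r Jrho (J ∩ Jrho) j ∧ sfun p f r Jrho (J ∩ Jrho) j ≤ (p : ℤ) - 1 := by
  simp only [sfun]
  split_ifs <;> omega

theorem dig_eq_of_modEq {p f : ℕ} {L : ℤ} (a : ℕ → ℕ) (ha : ∀ i < f, a i < p)
    (hlt : ∑ i ∈ range f, (a i : ℤ) * (p : ℤ) ^ i < (p : ℤ) ^ f - 1)
    (hL : L ≡ ∑ i ∈ range f, (a i : ℤ) * (p : ℤ) ^ i [ZMOD (p : ℤ) ^ f - 1])
    {k : ℕ} (hk : k < f) : dig p f L k = a k := by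
  have h₀ : 0 ≤ ∑ i ∈ range f, (a i : ℤ) * (p : ℤ) ^ i := by positivity
  have hmod : L % ((p : ℤ) ^ f - 1) = ((∑ i ∈ range f, a i * p ^ i : ℕ) : ℤ) := by
    rw [hL, Int.emod_eq_of_lt h₀ hlt]
    push_cast
    rfl
  rw [dig, hmod, Int.toNat_natCast, sum_mul_pow_div_mod f a ha hk]

/-- A number all of whose digits are at most `p - 2` is less than `p ^ n - 1`. -/
theorem sum_mul_pow_lt_pred {p : ℕ} {n : ℕ} (hn : 1 ≤ n) (a : ℕ → ℕ)
    (ha : ∀ i < n, a i + 1 < p) :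
    ∑ i ∈ range n, (a i : ℤ) * (p : ℤ) ^ i < (p : ℤ) ^ n - 1 := by
  have h₁ := sum_mul_pow_lt n (fun i => a i + 1) ha
  have h₂ : 1 ≤ ∑ i ∈ range n, p ^ i := by
    simpa using Finset.single_le_sum (f := fun i => p ^ i) (fun i _ => Nat.zero_le _)
      (mem_range.2 hn)
  simp only [add_mul, one_mul, Finset.sum_add_distrib] at h₁
  have h₃ : ∑ i ∈ range n, a i * p ^ i + 1 < p ^ n := by omega
  zify at h₃
  linarith

/-- congruence mod `q−1`, range of the right-hand side, and digits of the
left-hand side. -/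
theorem statement18 (p f : ℕ) [NeZero f] (hp : p.Prime) (hf : 1 ≤ f)
    (r : ZMod f → ℤ)
    (hr : ∀ j, max 12 (2 * (f : ℤ) + 1) ≤ r j ∧ r j ≤ (p : ℤ) - max 15 (2 * (f : ℤ) + 3))
    (Jrho J : Finset (ZMod f)) (hJ : ¬ J ⊆ Jrho)
    (L R : ℤ)
    (hL : L = (∑ j ∈ Finset.univ.filter (fun j : ZMod f => j + 1 ∉ J \ Jrho),
          ((p : ℤ) - 1 - sfun p f r Jrho (J ∩ Jrho) j) * (p : ℤ) ^ j.val)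
        + ∑ j : ZMod f, sfun p f r Jrho J j * (p : ℤ) ^ j.val)
    (hR : R = ∑ j ∈ Finset.univ.filter (fun j : ZMod f => j + 1 ∈ J \ Jrho),
          ((p : ℤ) - 1 - sfun p f r Jrho (J ∩ Jrho) j) * (p : ℤ) ^ j.val) :
    Int.ModEq ((p : ℤ) ^ f - 1) L R ∧
    0 ≤ R ∧ R ≤ (p : ℤ) ^ f - 2 ∧
    ∀ j : ZMod f,
      (dig p f L j.val : ℤ)
        = (if j + 1 ∈ J \ Jrho then 1 else 0) *
            ((p : ℤ) - 1 - sfun p f r Jrho (J ∩ Jrho) j) := by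
  set d : ZMod f → ℤ := fun j =>
    if j + 1 ∈ J \ Jrho then (p : ℤ) - 1 - sfun p f r Jrho (J ∩ Jrho) j else 0 with hd
  have hs : ∀ j, 1 ≤ sfun p f r Jrho (J ∩ Jrho) j ∧
      sfun p f r Jrho (J ∩ Jrho) j ≤ (p : ℤ) - 1 := fun j =>
    sfun_inter_mem_bounds Jrho J j (by have := hr j; omega) (by have := hr j; omega)
  have hd₀ : ∀ j, 0 ≤ d j ∧ d j + 1 < p := by
    intro j
    have h₁ := hs j
    have h₂ := hr j
    simp only [hd]
    split_ifs <;> omega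
  set a : ℕ → ℕ := fun i => (d (i : ZMod f)).toNat
  have had : ∀ i, (a i : ℤ) = d (i : ZMod f) := fun i => Int.toNat_of_nonneg (hd₀ _).1
  have ha : ∀ i < f, a i + 1 < p := by
    intro i _
    have h₁ := had i
    have h₂ := hd₀ (i : ZMod f)
    omega
  have hR' : R = ∑ j : ZMod f, d j * (p : ℤ) ^ j.val := by
    rw [hR, Finset.sum_filter]
    exact Finset.sum_congr rfl fun j _ => by simp only [hd, ite_mul, zero_mul]
  have hRa : R = ∑ i ∈ range f, (a i : ℤ) * (p : ℤ) ^ i := by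
    simp only [had]
    rw [hR', sum_zmod_mul_pow_val]
  have hLR : L - R = ((p : ℤ) ^ f - 1) * (if (0 : ZMod f) ∈ J \ Jrho then 0 else 1) := by
    rw [← sum_zmod_carry (p : ℤ) f (fun j => if j ∈ J \ Jrho then 0 else 1), hL, hR',
      Finset.sum_filter, ← Finset.sum_add_distrib, ← Finset.sum_sub_distrib]
    refine Finset.sum_congr rfl fun j _ => ?_
    rw [← sfun_carry p f r Jrho J j]
    simp only [hd, sub_mul, add_mul, ite_mul, zero_mul]
  have hmod : L ≡ R [ZMOD (p : ℤ) ^ f - 1] :=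
    (Int.modEq_iff_dvd.2 ⟨_, hLR⟩).symm
  have hlt : R < (p : ℤ) ^ f - 1 := hRa ▸ sum_mul_pow_lt_pred hf a ha
  refine ⟨hmod, ?_, by omega, fun j => ?_⟩
  · rw [hRa]
    positivity
  · rw [dig_eq_of_modEq a (fun i hi => by have := ha i hi; omega) (hRa ▸ hlt) (hRa ▸ hmod)
      (ZMod.val_lt j), had, ZMod.natCast_zmod_val]
    simp only [hd, ite_mul, one_mul, zero_mul]
end

section
/- Assume J_ρ ≠ 𝒥, let 𝔽 be a field, and let J* be the unique subset of 𝒥 with J* Δ (J*−1)^{ss} = 𝒥. Call a 2^f × 2^f matrix B over 𝔽, with rows and columns indexed by the subsets of 𝒥, admissible if: (a) B_{J,J′} ≠ 0 if and only if (J−1)^{ss} = (J′)^{ss}; and (b) B_{J_1,J_3}·B_{J_2,J_4} = B_{J_1,J_4}·B_{J_2,J_3} whenever (J_1−1)^{ss} = (J_2−1)^{ss} = J_3^{ss} = J_4^{ss}. For admissible B let Φ(B) be the tuple consisting of: B_{∅,∅}; B(J*) := B_{(J*−1)^{ss},J*}·B_{J*,(J*−1)^{ss}}; and, for each J ⊆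 𝒥 with J ⊄ J_ρ and J ≠ J*, B(J) := (B_{J″,J}/B_{J″,J^{ss}}) · (Π_{i=0}^{ℓ(J)−1} B_{δ_ss^i(J),δ_ss^{i+1}(J)}) / (Π_{i=0}^{ℓ(J^{ss})−1} B_{δ_ss^i(J^{ss}),δ_ss^{i+1}(J^{ss})}), where J″ is any subset of 𝒥 with (J″−1)^{ss} = J^{ss} (such J″ exists, all entries occurring are nonzero, and by (b) the value B(J) is independent of the choice of J″). Then: (1) if B is admissible and Q is an invertible diagonal matrix, then Q^{−1}BQ is admissible and Φ(Q^{−1}BQ) = Φ(B); (2) conversely, if B and C are admissible and Φ(B) = Φ(C), then there exists an invertible diagonal matrix Q with C = Q^{−1}BQ. -/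
open Finset
open scoped symmDiff

/-- `ℓ(J) = min {i ≥ 0 : δ_ss^i(J) = ∅}` (as an infimum in `ℕ`). -/
noncomputable def ellJ (f : ℕ) (Jrho J : Finset (ZMod f)) : ℕ :=
  sInf {i : ℕ | (deltaSS f Jrho)^[i] J = ∅}

/-- A `2^f × 2^f` matrix `B` (rows and columns indexed by the subsets of `𝒥`) is
admissible if `B_{J,J′} ≠ 0 ↔ (J−1)^{ss} = (J′)^{ss}` and the `2×2`-minor multiplicativity
condition holds. -/
def IsAdmissible (f : ℕ) {F : Type*} [Field F] (Jrho : Finset (ZMod f))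
    (B : Finset (ZMod f) → Finset (ZMod f) → F) : Prop :=
  (∀ J J' : Finset (ZMod f), B J J' ≠ 0 ↔ deltaSS f Jrho J = J' ∩ Jrho) ∧
  (∀ J1 J2 J3 J4 : Finset (ZMod f),
    deltaSS f Jrho J1 = deltaSS f Jrho J2 → deltaSS f Jrho J2 = J3 ∩ Jrho →
    J3 ∩ Jrho = J4 ∩ Jrho →
    B J1 J3 * B J2 J4 = B J1 J4 * B J2 J3)

/-- The quantity `B(J)` computed using an auxiliary subset `J″` with `(J″−1)^{ss} = J^{ss}`. -/
noncomputable def BJval (f : ℕ) {F : Type*} [Field F] (Jrho : Finset (ZMod f))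
    (B : Finset (ZMod f) → Finset (ZMod f) → F) (J J'' : Finset (ZMod f)) : F :=
  (B J'' J / B J'' (J ∩ Jrho)) *
    (∏ i ∈ Finset.range (ellJ f Jrho J),
      B ((deltaSS f Jrho)^[i] J) ((deltaSS f Jrho)^[i + 1] J)) /
    (∏ i ∈ Finset.range (ellJ f Jrho (J ∩ Jrho)),
      B ((deltaSS f Jrho)^[i] (J ∩ Jrho)) ((deltaSS f Jrho)^[i + 1] (J ∩ Jrho)))

/-- `Φ(B) = Φ(C)`: the two admissible matrices have the same distinguishing tuple. -/
def PhiEq (f : ℕ) {F : Type*} [Field F] (Jrho Jstar : Finset (ZMod f))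
    (B C : Finset (ZMod f) → Finset (ZMod f) → F) : Prop :=
  B ∅ ∅ = C ∅ ∅ ∧
  B (deltaSS f Jrho Jstar) Jstar * B Jstar (deltaSS f Jrho Jstar)
    = C (deltaSS f Jrho Jstar) Jstar * C Jstar (deltaSS f Jrho Jstar) ∧
  ∀ J : Finset (ZMod f), ¬ J ⊆ Jrho → J ≠ Jstar →
    ∀ J'' : Finset (ZMod f), deltaSS f Jrho J'' = J ∩ Jrho →
      BJval f Jrho B J J'' = BJval f Jrho C J J''

theorem deltaSS_empty (f : ℕ) (Jrho : Finset (ZMod f)) : deltaSS f Jrho ∅ = ∅ := by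
  ext j
  simp [mem_deltaSS]

theorem deltaSS_inter_self (f : ℕ) (Jrho J : Finset (ZMod f)) :
    deltaSS f Jrho J ∩ Jrho = deltaSS f Jrho J := by
  ext j
  simp +contextual [mem_deltaSS]

theorem add_mem_of_mem_iterate_deltaSS {f : ℕ} {Jrho : Finset (ZMod f)} (i : ℕ) :
    ∀ {J : Finset (ZMod f)} {j : ZMod f}, j ∈ (deltaSS f Jrho)^[i] J →
      ∀ k < i, j + (k : ZMod f) ∈ Jrho := by
  induction i with
  | zero => intro J j _ k hk; omega
  | succ i ih =>
    intro J j hj k hk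
    rw [Function.iterate_succ_apply', mem_deltaSS] at hj
    rcases k with _ | k
    · simpa using hj.2
    · have := ih hj.1 k (by omega)
      push_cast
      rwa [add_comm (k : ZMod f), ← add_assoc]

theorem iterate_deltaSS_eq_empty {f : ℕ} [NeZero f] {Jrho : Finset (ZMod f)}
    (hJrho : Jrho ≠ Finset.univ) (J : Finset (ZMod f)) : (deltaSS f Jrho)^[f] J = ∅ := by
  by_contra hne
  obtain ⟨j, hj⟩ := Finset.nonempty_iff_ne_empty.mpr hne
  refine hJrho (Finset.eq_univ_iff_forall.mpr fun a => ?_)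
  have := add_mem_of_mem_iterate_deltaSS f hj (a - j).val (ZMod.val_lt _)
  rwa [ZMod.natCast_zmod_val, add_sub_cancel] at this

theorem deltaSS_induction {f : ℕ} [NeZero f] {Jrho : Finset (ZMod f)}
    (hJrho : Jrho ≠ Finset.univ) {P : Finset (ZMod f) → Prop} (empty : P ∅)
    (step : ∀ J, J ≠ ∅ → P (deltaSS f Jrho J) → P J) (J : Finset (ZMod f)) : P J := by
  have key : ∀ (i : ℕ) (J : Finset (ZMod f)), (deltaSS f Jrho)^[i] J = ∅ → P J := by
    intro i
    induction i with
    | zero => intro J hJ; exact (show J = ∅ from hJ) ▸ empty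
    | succ i ih =>
      intro J hJ
      by_cases h : J = ∅
      · exact h ▸ empty
      · exact step J h (ih _ hJ)
  exact key f J (iterate_deltaSS_eq_empty hJrho J)

theorem ellJ_empty (f : ℕ) (Jrho : Finset (ZMod f)) : ellJ f Jrho ∅ = 0 :=
  Nat.sInf_eq_zero.mpr (Or.inl rfl)

theorem ellJ_eq_succ {f : ℕ} [NeZero f] {Jrho : Finset (ZMod f)}
    (hJrho : Jrho ≠ Finset.univ) {J : Finset (ZMod f)} (hJ : J ≠ ∅) :
    ellJ f Jrho J = ellJ f Jrho (deltaSS f Jrho J) + 1 := by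
  have hne : ∃ n, n ∈ {i : ℕ | (deltaSS f Jrho)^[i] J = ∅} :=
    ⟨f, iterate_deltaSS_eq_empty hJrho J⟩
  have hpos : 0 < sInf {i : ℕ | (deltaSS f Jrho)^[i] J = ∅} := by
    refine Nat.pos_of_ne_zero fun h => ?_
    rcases Nat.sInf_eq_zero.mp h with h0 | h0
    · exact hJ h0
    · exact Set.nonempty_iff_ne_empty.mp hne h0
  exact (Nat.sInf_add (n := 1) (p := fun i => (deltaSS f Jrho)^[i] J = ∅) hpos).symm

/-- The product of the entries of `B` along the `δ_ss`-orbit of `J` down to `∅`. -/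
noncomputable def orbitProd (f : ℕ) {F : Type*} [Field F] (Jrho : Finset (ZMod f))
    (B : Finset (ZMod f) → Finset (ZMod f) → F) (J : Finset (ZMod f)) : F :=
  ∏ i ∈ Finset.range (ellJ f Jrho J), B ((deltaSS f Jrho)^[i] J) ((deltaSS f Jrho)^[i + 1] J)

section orbitProd

variable {f : ℕ} {F : Type*} [Field F] {Jrho : Finset (ZMod f)}
  {B : Finset (ZMod f) → Finset (ZMod f) → F}

theorem orbitProd_empty : orbitProd f Jrho B ∅ = 1 := by
  simp [orbitProd, ellJ_empty]

theorem orbitProd_eq_mul [NeZero f] (hJrho : Jrho ≠ Finset.univ) {J : Finset (ZMod f)}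
    (hJ : J ≠ ∅) :
    orbitProd f Jrho B J =
      B J (deltaSS f Jrho J) * orbitProd f Jrho B (deltaSS f Jrho J) := by
  rw [orbitProd, ellJ_eq_succ hJrho hJ, Finset.prod_range_succ', mul_comm]
  rfl

theorem IsAdmissible.apply_deltaSS_ne_zero (hB : IsAdmissible f Jrho B) (J : Finset (ZMod f)) :
    B J (deltaSS f Jrho J) ≠ 0 :=
  (hB.1 _ _).mpr (deltaSS_inter_self f Jrho J).symm

theorem IsAdmissible.orbitProd_ne_zero (hB : IsAdmissible f Jrho B) (J : Finset (ZMod f)) :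
    orbitProd f Jrho B J ≠ 0 := by
  refine Finset.prod_ne_zero_iff.mpr fun i _ => ?_
  rw [Function.iterate_succ_apply']
  exact hB.apply_deltaSS_ne_zero _

theorem orbitProd_conj [NeZero f] (hJrho : Jrho ≠ Finset.univ) {d : Finset (ZMod f) → F}
    (hd : ∀ J, d J ≠ 0) (J : Finset (ZMod f)) :
    orbitProd f Jrho (fun J J' => (d J)⁻¹ * B J J' * d J') J =
      (d J)⁻¹ * orbitProd f Jrho B J * d ∅ := by
  induction J using deltaSS_induction hJrho with
  | empty => simp [orbitProd_empty, hd]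
  | step J hJ ih =>
    rw [orbitProd_eq_mul hJrho hJ, orbitProd_eq_mul hJrho hJ, ih]
    have := hd (deltaSS f Jrho J)
    field_simp

theorem BJval_eq (J J'' : Finset (ZMod f)) :
    BJval f Jrho B J J'' = B J'' J / B J'' (J ∩ Jrho) * orbitProd f Jrho B J /
      orbitProd f Jrho B (J ∩ Jrho) := rfl

end orbitProd

theorem deltaSS_deltaSS_of_symmDiff_eq_univ {f : ℕ} [NeZero f]
    {Jrho Jstar : Finset (ZMod f)}
    (hstar : Jstar ∆ deltaSS f Jrho Jstar = Finset.univ) :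
    deltaSS f Jrho (deltaSS f Jrho Jstar) = Jstar ∩ Jrho := by
  have h : ∀ j, j ∈ deltaSS f Jrho Jstar ↔ j ∉ Jstar := by
    intro j
    have := Finset.eq_univ_iff_forall.mp hstar j
    rw [Finset.mem_symmDiff] at this
    tauto
  ext j
  have h1 := h j
  have h2 := h (j + 1)
  rw [mem_deltaSS] at h1
  rw [mem_deltaSS, Finset.mem_inter, h2]
  tauto

section conjugation

variable {f : ℕ} {F : Type*} [Field F] {Jrho Jstar : Finset (ZMod f)}
  {B C : Finset (ZMod f) → Finset (ZMod f) → F} {d : Finset (ZMod f) → F}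

theorem IsAdmissible.conj (hB : IsAdmissible f Jrho B) (hd : ∀ J, d J ≠ 0) :
    IsAdmissible f Jrho (fun J J' => (d J)⁻¹ * B J J' * d J') := by
  refine ⟨fun J J' => ?_, fun J1 J2 J3 J4 h1 h2 h3 => ?_⟩
  · rw [← hB.1 J J']
    simp [hd]
  · linear_combination (d J1)⁻¹ * (d J2)⁻¹ * d J3 * d J4 * hB.2 J1 J2 J3 J4 h1 h2 h3

theorem phiEq_conj [NeZero f] (hJrho : Jrho ≠ Finset.univ) (hB : IsAdmissible f Jrho B)
    (hd : ∀ J, d J ≠ 0) :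
    PhiEq f Jrho Jstar (fun J J' => (d J)⁻¹ * B J J' * d J') B := by
  refine ⟨?_, ?_, fun J _ _ J'' hJ'' => ?_⟩
  · have := hd ∅
    field_simp
  · have := hd Jstar
    have := hd (deltaSS f Jrho Jstar)
    field_simp
  · rw [BJval_eq, BJval_eq, orbitProd_conj hJrho hd, orbitProd_conj hJrho hd]
    have h0 := hd ∅
    have h1 := hd J
    have h2 := hd (J ∩ Jrho)
    have h3 := hd J''
    have h4 := hB.orbitProd_ne_zero (J ∩ Jrho)
    have h5 : B J'' (J ∩ Jrho) ≠ 0 := hJ'' ▸ hB.apply_deltaSS_ne_zero J''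
    field_simp

theorem apply_deltaSS_eq_conj_orbitProd [NeZero f] (hJrho : Jrho ≠ Finset.univ)
    (hB : IsAdmissible f Jrho B) (hC : IsAdmissible f Jrho C) (h0 : B ∅ ∅ = C ∅ ∅)
    (J : Finset (ZMod f)) :
    C J (deltaSS f Jrho J) = (orbitProd f Jrho B J / orbitProd f Jrho C J)⁻¹ *
      B J (deltaSS f Jrho J) *
      (orbitProd f Jrho B (deltaSS f Jrho J) / orbitProd f Jrho C (deltaSS f Jrho J)) := by
  by_cases hJ : J = ∅
  · subst hJ
    simp [deltaSS_empty, orbitProd_empty, h0]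
  · rw [orbitProd_eq_mul (B := B) hJrho hJ, orbitProd_eq_mul (B := C) hJrho hJ]
    have h1 := hB.orbitProd_ne_zero (deltaSS f Jrho J)
    have h2 := hC.orbitProd_ne_zero (deltaSS f Jrho J)
    have h3 := hB.apply_deltaSS_ne_zero J
    have h4 := hC.apply_deltaSS_ne_zero J
    field_simp

theorem PhiEq.exists_conj [NeZero f] (hJrho : Jrho ≠ Finset.univ)
    (hstar : Jstar ∆ deltaSS f Jrho Jstar = Finset.univ)
    (hB : IsAdmissible f Jrho B) (hC : IsAdmissible f Jrho C) (h : PhiEq f Jrho Jstar B C) :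
    ∃ d : Finset (ZMod f) → F, (∀ J, d J ≠ 0) ∧
      ∀ J J' : Finset (ZMod f), C J J' = (d J)⁻¹ * B J J' * d J' := by
  obtain ⟨h0, hs, hval⟩ := h
  have hdelta := apply_deltaSS_eq_conj_orbitProd hJrho hB hC h0
  set d : Finset (ZMod f) → F := fun J => orbitProd f Jrho B J / orbitProd f Jrho C J with hdef
  have hd : ∀ J, d J ≠ 0 := fun J =>
    div_ne_zero (hB.orbitProd_ne_zero J) (hC.orbitProd_ne_zero J)
  replace hdelta : ∀ J, C J (deltaSS f Jrho J) =
    (d J)⁻¹ * B J (deltaSS f Jrho J) * d (deltaSS f Jrho J) := hdelta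
  refine ⟨d, hd, fun J J' => ?_⟩
  by_cases hJ : deltaSS f Jrho J = J' ∩ Jrho
  swap
  · have hB0 : B J J' = 0 := by_contra fun hne => hJ ((hB.1 _ _).mp hne)
    have hC0 : C J J' = 0 := by_contra fun hne => hJ ((hC.1 _ _).mp hne)
    simp [hB0, hC0]
  by_cases hsub : J' ⊆ Jrho
  · rw [Finset.inter_eq_left.mpr hsub] at hJ
    exact hJ ▸ hdelta J
  have hCJ := hdelta J
  rw [hJ] at hCJ
  have hBne : B J (J' ∩ Jrho) ≠ 0 := hJ ▸ hB.apply_deltaSS_ne_zero J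
  have hCne : C J (J' ∩ Jrho) ≠ 0 := hJ ▸ hC.apply_deltaSS_ne_zero J
  have d1 := hd J
  have d2 := hd J'
  have d3 := hd (J' ∩ Jrho)
  by_cases hJs : J' = Jstar
  · subst hJs
    have hdd := deltaSS_deltaSS_of_symmDiff_eq_univ hstar
    set K := deltaSS f Jrho J' with hK
    have d4 := hd K
    have hKJ : C K J' = (d K)⁻¹ * B K J' * d J' := by
      have hne : B J' K ≠ 0 := hB.apply_deltaSS_ne_zero J'
      rw [hdelta J', ← hK] at hs
      field_simp at hs ⊢
      linear_combination -hs
    have hCK := hdelta K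
    rw [hdd] at hCK
    have hBK : B K (J' ∩ Jrho) ≠ 0 := hdd ▸ hB.apply_deltaSS_ne_zero K
    have hi : J' ∩ Jrho = J' ∩ Jrho ∩ Jrho := by simp
    have hmB := hB.2 J K J' (J' ∩ Jrho) (hJ.trans hdd.symm) hdd hi
    have hmC := hC.2 J K J' (J' ∩ Jrho) (hJ.trans hdd.symm) hdd hi
    rw [hCK, hCJ, hKJ] at hmC
    have hscale : (d K)⁻¹ * B K (J' ∩ Jrho) * d (J' ∩ Jrho) ≠ 0 := by simp [hBK, d3, d4]
    apply mul_right_cancel₀ hscale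
    rw [hmC]
    linear_combination -(d J)⁻¹ * (d K)⁻¹ * d (J' ∩ Jrho) * d J' * hmB
  · have hv := hval J' hsub hJs J hJ
    rw [BJval_eq, BJval_eq, hCJ] at hv
    have p1 := hB.orbitProd_ne_zero J'
    have p2 := hC.orbitProd_ne_zero J'
    have p3 := hB.orbitProd_ne_zero (J' ∩ Jrho)
    have p4 := hC.orbitProd_ne_zero (J' ∩ Jrho)
    have e1 : orbitProd f Jrho B J' = d J' * orbitProd f Jrho C J' := by
      simp only [hdef]; field_simp
    have e2 : orbitProd f Jrho B (J' ∩ Jrho) =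
        d (J' ∩ Jrho) * orbitProd f Jrho C (J' ∩ Jrho) := by
      simp only [hdef]; field_simp
    rw [e1, e2] at hv
    clear_value d
    field_simp at hv ⊢
    linear_combination -hv

end conjugation

/-- an admissible matrix is determined, up to conjugation by invertible
diagonal matrices, by the tuple `Φ(B)`. -/
theorem statement19 (f : ℕ) [NeZero f] (hf : 1 ≤ f) (F : Type*) [Field F]
    (Jrho : Finset (ZMod f)) (hJrho : Jrho ≠ Finset.univ)
    (Jstar : Finset (ZMod f)) (hstar : Jstar ∆ deltaSS f Jrho Jstar = Finset.univ) :
    (∀ (B : Finset (ZMod f) → Finset (ZMod f) → F) (d : Finset (ZMod f) → F),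
      IsAdmissible f Jrho B → (∀ J, d J ≠ 0) →
      IsAdmissible f Jrho (fun J J' => (d J)⁻¹ * B J J' * d J') ∧
      PhiEq f Jrho Jstar (fun J J' => (d J)⁻¹ * B J J' * d J') B) ∧
    (∀ B C : Finset (ZMod f) → Finset (ZMod f) → F,
      IsAdmissible f Jrho B → IsAdmissible f Jrho C → PhiEq f Jrho Jstar B C →
      ∃ d : Finset (ZMod f) → F, (∀ J, d J ≠ 0) ∧
        ∀ J J' : Finset (ZMod f), C J J' = (d J)⁻¹ * B J J' * d J') := by
  exact ⟨fun _ _ hB hd => ⟨hB.conj hd, phiEq_conj hJrho hB hd⟩,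
    fun _ _ hB hC h => h.exists_conj hJrho hstar hB hC⟩
end
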